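/- arXiv:math/0506618 — 2 statements merged into one kernel-verified Lean document; each statement's English description precedes it below -/
import Mathlib

section
/- For all integers m ≥ 3 and n ≥ 0, with η = 3^m + 2n − 1: the vertex sets of the faces C_i, i ∈ ℤ/ηℤ, are pairwise distinct (so there are exactly η faces), and every element v ∈ ℤ/ηℤ lies in the vertex set of exactly 2m of the faces C_j. -/
/-- The sequence `b` : `b (2l-1) = 3^(l-1) - 1`, `b (2l) = 2·3^(l-1) - 1` (for `k ≥ 1`). -/
def bseq (k : ℕ) : ℤ := if k % 2 = 1 then 3 ^ (k / 2) - 1 else 2 * 3 ^ (k / 2 - 1) - 1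

/-- Offsets of the face `C_i` in the even case `M_{2m, 3^m+2n-1}`. -/
def evenOff (m n k : ℕ) : ℤ := bseq k + (if k = 2 * m then (n : ℤ) else 0)

/-- The entries of the face `C_i` (even case). -/
def Cface (m n : ℕ) (i : ZMod (3 ^ m + 2 * n - 1)) :
    Fin (2 * m) → ZMod (3 ^ m + 2 * n - 1) :=
  fun j => i + (evenOff m n (j.1 + 1) : ZMod (3 ^ m + 2 * n - 1))

theorem bseq_two_mul_add_one (l : ℕ) : bseq (2 * l + 1) = 3 ^ l - 1 := by
  have h₁ : (2 * l + 1) % 2 = 1 := by omega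
  have h₂ : (2 * l + 1) / 2 = l := by omega
  simp [bseq, h₁, h₂]

theorem bseq_two_mul_add_two (l : ℕ) : bseq (2 * l + 2) = 2 * 3 ^ l - 1 := by
  simp [bseq]

theorem bseq_succ_strictMono : StrictMono fun k => bseq (k + 1) := by
  refine strictMono_nat_of_lt_succ fun k => ?_
  rcases Nat.even_or_odd' k with ⟨l, rfl | rfl⟩
  · have h : (0 : ℤ) < 3 ^ l := by positivity
    rw [bseq_two_mul_add_one, bseq_two_mul_add_two]
    linarith
  · have h : (0 : ℤ) < 3 ^ l := by positivity
    have e : bseq (2 * l + 1 + 1 + 1) = 3 ^ (l + 1) - 1 := bseq_two_mul_add_one (l + 1)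
    rw [e, bseq_two_mul_add_two, pow_succ]
    linarith

theorem bseq_succ_nonneg (k : ℕ) : 0 ≤ bseq (k + 1) := by
  have h := bseq_succ_strictMono.monotone (Nat.zero_le k)
  simpa [bseq] using h

/-- Past its first two terms `0, 1`, the sequence is constantly `2` modulo `3`. -/
theorem bseq_succ_cases (k : ℕ) :
    bseq (k + 1) = 0 ∨ bseq (k + 1) = 1 ∨ bseq (k + 1) % 3 = 2 := by
  rcases Nat.even_or_odd' k with ⟨l, rfl | rfl⟩ <;> cases l with
  | zero => simp [bseq]
  | succ l =>
    first
    | rw [bseq_two_mul_add_one, pow_succ]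
    | rw [bseq_two_mul_add_two, pow_succ]
    omega

theorem evenOff_of_lt {m n k : ℕ} (h : k + 1 < 2 * m) : evenOff m n (k + 1) = bseq (k + 1) := by
  simp [evenOff, h.ne]

theorem evenOff_last (m n : ℕ) :
    evenOff (m + 1) n (2 * m + 2) = 2 * 3 ^ m - 1 + n := by
  rw [evenOff, bseq_two_mul_add_two, if_pos (by ring)]

/-- Every offset but the last is at most `3 ^ m - 1`, and is `0`, `1` or `2` modulo `3`. -/
theorem evenOff_cases {m n k : ℕ} (hk : k < 2 * (m + 1)) :
    0 ≤ evenOff (m + 1) n (k + 1) ∧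
    (evenOff (m + 1) n (k + 1) = 2 * 3 ^ m - 1 + n ∨
      evenOff (m + 1) n (k + 1) ≤ 3 ^ m - 1 ∧
        (evenOff (m + 1) n (k + 1) = 0 ∨ evenOff (m + 1) n (k + 1) = 1 ∨
          evenOff (m + 1) n (k + 1) % 3 = 2)) := by
  rcases (by omega : k = 2 * m + 1 ∨ k ≤ 2 * m) with rfl | h
  · have hp : (0 : ℤ) < 3 ^ m := by positivity
    rw [evenOff_last]
    exact ⟨by omega, Or.inl rfl⟩
  · rw [evenOff_of_lt (by omega)]
    have hle := bseq_succ_strictMono.monotone h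
    simp only [bseq_two_mul_add_one] at hle
    exact ⟨bseq_succ_nonneg k, Or.inr ⟨hle, bseq_succ_cases k⟩⟩

theorem evenOff_strictMono (m n : ℕ) :
    StrictMono fun j : Fin (2 * m) => evenOff m n (j.1 + 1) := by
  intro a b hab
  have hlt : bseq (a.1 + 1) < bseq (b.1 + 1) := bseq_succ_strictMono hab
  have hb := b.2
  have hab' : a.1 < b.1 := hab
  change evenOff m n (a.1 + 1) < evenOff m n (b.1 + 1)
  rw [evenOff_of_lt (by omega)]
  unfold evenOff
  split_ifs <;> omega

theorem natCast_modulus (m n : ℕ) :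
    ((3 ^ (m + 1) + 2 * n - 1 : ℕ) : ℤ) = 3 * 3 ^ m + 2 * n - 1 := by
  have h : 0 < 3 ^ m := by positivity
  rw [pow_succ]
  zify [show 1 ≤ 3 ^ m * 3 + 2 * n by omega]
  ring

theorem ZMod.eq_of_intCast_eq {N : ℕ} {a b : ℤ} (ha : 0 ≤ a) (haN : a < N) (hb : 0 ≤ b)
    (hbN : b < N) (h : (a : ZMod N) = b) : a = b := by
  rwa [ZMod.intCast_eq_intCast_iff', Int.emod_eq_of_lt ha haN, Int.emod_eq_of_lt hb hbN] at h

theorem evenOff_add_one_lt {m n k : ℕ} (hm : 1 ≤ m) (hk : k < 2 * (m + 1)) :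
    evenOff (m + 1) n (k + 1) + 1 < (3 ^ (m + 1) + 2 * n - 1 : ℕ) := by
  have hp : (3 : ℤ) ≤ 3 ^ m := le_self_pow₀ (by norm_num) (by omega)
  rw [natCast_modulus]
  have := evenOff_cases (n := n) hk
  omega

theorem evenOff_cast_injective {m : ℕ} (n : ℕ) (hm : 1 ≤ m) :
    Function.Injective fun j : Fin (2 * (m + 1)) =>
      (evenOff (m + 1) n (j.1 + 1) : ZMod (3 ^ (m + 1) + 2 * n - 1)) := by
  intro a b hab
  have ha := evenOff_add_one_lt (n := n) hm a.2
  have hb := evenOff_add_one_lt (n := n) hm b.2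
  exact (evenOff_strictMono (m + 1) n).injective
    (ZMod.eq_of_intCast_eq (evenOff_cases a.2).1 (by omega) (evenOff_cases b.2).1 (by omega) hab)

/-- The only offsets whose successor is again an offset modulo `η` are `0` and `1`. -/
theorem evenOff_eq_zero_or_one {m n a b : ℕ} (hm : 1 ≤ m) (ha : a < 2 * (m + 1))
    (hb : b < 2 * (m + 1))
    (h : (evenOff (m + 1) n (b + 1) : ZMod (3 ^ (m + 1) + 2 * n - 1)) =
      evenOff (m + 1) n (a + 1) + 1) :
    evenOff (m + 1) n (b + 1) = evenOff (m + 1) n (a + 1) + 1 ∧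
      (evenOff (m + 1) n (a + 1) = 0 ∨ evenOff (m + 1) n (a + 1) = 1) := by
  have hp : (3 : ℤ) ≤ 3 ^ m := le_self_pow₀ (by norm_num) (by omega)
  have hca := evenOff_cases (n := n) ha
  have hcb := evenOff_cases (n := n) hb
  have hla := evenOff_add_one_lt (n := n) hm ha
  have hlb := evenOff_add_one_lt (n := n) hm hb
  have key : evenOff (m + 1) n (b + 1) = evenOff (m + 1) n (a + 1) + 1 :=
    ZMod.eq_of_intCast_eq hcb.1 (by omega) (by omega) hla (by push_cast; exact h)
  exact ⟨key, by omega⟩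

/-- for `m ≥ 3`, `n ≥ 0`, `η = 3^m + 2n - 1`: the vertex sets of the faces
`C_i`, `i ∈ ℤ/ηℤ`, are pairwise distinct (so there are exactly `η` faces), and every
`v ∈ ℤ/ηℤ` lies in the vertex set of exactly `2m` of the faces `C_j`. -/
theorem Cface_vertexSets_distinct_and_degree (m n : ℕ) (hm : 3 ≤ m) :
    (∀ i i' : ZMod (3 ^ m + 2 * n - 1),
      Set.range (Cface m n i) = Set.range (Cface m n i') → i = i') ∧
    (∀ v : ZMod (3 ^ m + 2 * n - 1),
      Nat.card {j : ZMod (3 ^ m + 2 * n - 1) // v ∈ Set.range (Cface m n j)} = 2 * m) := by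
  obtain ⟨m, rfl⟩ : ∃ k, m = k + 1 := ⟨m - 1, by omega⟩
  have hm₁ : 1 ≤ m := by omega
  refine ⟨fun i i' h => ?_, fun v => ?_⟩
  · have mem (k : ℕ) (hk : k < 2 * (m + 1)) : ∃ j, Cface (m + 1) n i' j =
        i + (evenOff (m + 1) n (k + 1) : ZMod (3 ^ (m + 1) + 2 * n - 1)) :=
      h.subset (Set.mem_range_self (⟨k, hk⟩ : Fin (2 * (m + 1))))
    obtain ⟨a, ha⟩ := mem 0 (by omega)
    obtain ⟨b, hb⟩ := mem 1 (by omega)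
    obtain ⟨c, hc⟩ := mem 2 (by omega)
    rw [evenOff_of_lt (by omega)] at ha hb hc
    norm_num [Cface, bseq] at ha hb hc
    obtain ⟨hab, -⟩ := evenOff_eq_zero_or_one hm₁ a.2 b.2 (by linear_combination hb - ha)
    obtain ⟨-, hb₁⟩ := evenOff_eq_zero_or_one hm₁ b.2 c.2 (by linear_combination hc - hb)
    have ha₀ : evenOff (m + 1) n (a.1 + 1) = 0 := by
      have := (evenOff_cases (n := n) a.2).1
      omega
    simpa [ha₀] using ha.symm
  · let f : Fin (2 * (m + 1)) →
        {j : ZMod (3 ^ (m + 1) + 2 * n - 1) // v ∈ Set.range (Cface (m + 1) n j)} :=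
      fun a => ⟨v - (evenOff (m + 1) n (a.1 + 1) : ZMod (3 ^ (m + 1) + 2 * n - 1)),
        a, by simp [Cface]⟩
    have hf : Function.Bijective f := by
      refine ⟨fun a b hab => evenOff_cast_injective n hm₁ ?_, ?_⟩
      · simpa [f] using congrArg Subtype.val hab
      · rintro ⟨j, a, ha⟩
        exact ⟨a, Subtype.ext (sub_eq_of_eq_add ha.symm)⟩
    rw [← Nat.card_congr (Equiv.ofBijective f hf), Nat.card_fin]
end

section
/- (Self-duality, odd case, Lemma 3.) For all integers m ≥ 3 and n ≥ 0, with N = 2(3^{m−1} + 2n − 1), and for all i, v, v′ ∈ ℤ/Nℤ: (a) v lies in the vertex set of F_i if and only if −i lies in the vertex set of F_{−v}; (b) if {v, v′} is an edge of F_i, then the vertex sets of F_{−v} and F_{−v′} both contain −i and intersect in exactly two elements. (Hence the bijection v ↦ F_{−v} carries each face F_i of the map to a cycle of pairwise-adjacent faces through the vertex −i, i.e., to a face of the dual map, so the map M_{2m−1, N} is self dual.) -/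
/-- Offsets of the face `F_i` in the odd case `M_{2m-1, 2(3^{m-1}+2n-1)}`. -/
def oddOff (m n k : ℕ) : ℤ :=
  bseq k + (if k = 2 * m - 2 then (n : ℤ) else if k = 2 * m - 1 then 2 * (n : ℤ) else 0)

/-- The entries of the face `F_i` (odd case). -/
def Fface (m n : ℕ) (i : ZMod (2 * (3 ^ (m - 1) + 2 * n - 1))) :
    Fin (2 * m - 1) → ZMod (2 * (3 ^ (m - 1) + 2 * n - 1)) :=
  fun j => i + (oddOff m n (j.1 + 1) : ZMod (2 * (3 ^ (m - 1) + 2 * n - 1)))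

/-- `e` is an edge of the face `F_j`: a set of two cyclically consecutive entries. -/
def IsFedge (m n : ℕ) (j : ZMod (2 * (3 ^ (m - 1) + 2 * n - 1)))
    (e : Set (ZMod (2 * (3 ^ (m - 1) + 2 * n - 1)))) : Prop :=
  ∃ t : Fin (2 * m - 1), e = {Fface m n j t, Fface m n j (finRotate (2 * m - 1) t)}

/-- The common difference of the entries with indices `2k`, `2k+1`, `2k+2` of a face. -/
def faceGap (m n k : ℕ) : ℤ := 3 ^ k + if k + 2 = m then (n : ℤ) else 0

theorem faceGap_pos (m n k : ℕ) : 0 < faceGap m n k := by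
  unfold faceGap
  split_ifs <;> positivity

theorem oddOff_even {m k : ℕ} (n : ℕ) (hk : k + 2 ≤ m) :
    oddOff m n (2 * k + 1) = 3 ^ k - 1 := by
  have h1 : (2 * k + 1) % 2 = 1 := by omega
  have h2 : (2 * k + 1) / 2 = k := by omega
  have h3 : ¬ 2 * k + 1 = 2 * m - 2 := by omega
  have h4 : ¬ 2 * k + 1 = 2 * m - 1 := by omega
  simp [oddOff, bseq, h1, h2, h3, h4]

theorem oddOff_one {m : ℕ} (n : ℕ) (hm : 3 ≤ m) : oddOff m n 1 = 0 := by
  simpa using oddOff_even (k := 0) n (by omega : 0 + 2 ≤ m)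

theorem oddOff_last {m : ℕ} (n : ℕ) (hm : 3 ≤ m) :
    oddOff m n (2 * m - 1) = 3 ^ (m - 1) - 1 + 2 * n := by
  have h1 : (2 * m - 1) % 2 = 1 := by omega
  have h2 : (2 * m - 1) / 2 = m - 1 := by omega
  have h3 : ¬ 2 * m - 1 = 2 * m - 2 := by omega
  simp [oddOff, bseq, h1, h2, h3]

theorem oddOff_even_lt {m k : ℕ} (n : ℕ) (hk : k + 2 ≤ m) :
    oddOff m n (2 * k + 1) < faceGap m n k := by
  rw [oddOff_even n hk]
  unfold faceGap
  split_ifs <;> omega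

theorem oddOff_odd {m k : ℕ} (n : ℕ) (hk : k + 2 ≤ m) :
    oddOff m n (2 * k + 2) = oddOff m n (2 * k + 1) + faceGap m n k := by
  rw [oddOff_even n hk]
  have h1 : ¬ (2 * k + 2) % 2 = 1 := by omega
  have h2 : (2 * k + 2) / 2 - 1 = k := by omega
  have h4 : ¬ 2 * k + 2 = 2 * m - 1 := by omega
  have h3 : 2 * k + 2 = 2 * m - 2 ↔ k + 2 = m := by omega
  simp only [oddOff, bseq, faceGap, h1, h2, h3, h4, if_false]
  ring

theorem oddOff_even_succ {m k : ℕ} (n : ℕ) (hk : k + 2 ≤ m) :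
    oddOff m n (2 * k + 3) = oddOff m n (2 * k + 1) + 2 * faceGap m n k := by
  rw [oddOff_even n hk]
  have h1 : (2 * k + 3) % 2 = 1 := by omega
  have h2 : (2 * k + 3) / 2 = k + 1 := by omega
  have h4 : ¬ 2 * k + 3 = 2 * m - 2 := by omega
  have h3 : 2 * k + 3 = 2 * m - 1 ↔ k + 2 = m := by omega
  simp only [oddOff, bseq, faceGap, h1, h2, h3, h4, if_true, if_false]
  split_ifs <;> ring

theorem exists_faceGap {m j : ℕ} (n : ℕ) (hj : j + 1 < 2 * m - 1) :
    ∃ k, k + 2 ≤ m ∧ (j = 2 * k ∨ j = 2 * k + 1) ∧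
      oddOff m n (j + 2) = oddOff m n (j + 1) + faceGap m n k := by
  rcases Nat.even_or_odd' j with ⟨k, rfl | rfl⟩
  · exact ⟨k, by omega, by omega, oddOff_odd n (by omega)⟩
  · refine ⟨k, by omega, by omega, ?_⟩
    have h1 := oddOff_odd (m := m) (k := k) n (by omega)
    have h2 := oddOff_even_succ (m := m) (k := k) n (by omega)
    change oddOff m n (2 * k + 3) = oddOff m n (2 * k + 2) + _
    omega

theorem oddOff_lt {m a b : ℕ} (n : ℕ) (hab : a < b) (hb : b < 2 * m - 1) :
    oddOff m n (a + 1) < oddOff m n (b + 1) := by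
  induction b, hab using Nat.le_induction with
  | base =>
    obtain ⟨k, -, -, h⟩ := exists_faceGap n hb
    have := faceGap_pos m n k
    change _ < oddOff m n (a + 2)
    omega
  | succ b _ ih =>
    obtain ⟨k, -, -, h⟩ := exists_faceGap n hb
    have := faceGap_pos m n k
    have := ih (by omega)
    change _ < oddOff m n (b + 2)
    omega

theorem oddOff_le {m a b : ℕ} (n : ℕ) (hab : a ≤ b) (hb : b < 2 * m - 1) :
    oddOff m n (a + 1) ≤ oddOff m n (b + 1) := by
  rcases hab.eq_or_lt with rfl | h
  · rfl
  · exact (oddOff_lt n h hb).le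

theorem oddOff_inj {m a b : ℕ} {n : ℕ} (ha : a < 2 * m - 1) (hb : b < 2 * m - 1)
    (h : oddOff m n (a + 1) = oddOff m n (b + 1)) : a = b := by
  rcases lt_trichotomy a b with h' | h' | h'
  · have := oddOff_lt n h' hb
    omega
  · exact h'
  · have := oddOff_lt n h' ha
    omega

theorem oddOff_nonneg {m a : ℕ} (n : ℕ) (hm : 3 ≤ m) (ha : a < 2 * m - 1) :
    0 ≤ oddOff m n (a + 1) := by
  rw [← oddOff_one n hm]
  exact oddOff_le n a.zero_le ha

theorem oddOff_le_last {m a : ℕ} (n : ℕ) (ha : a < 2 * m - 1) :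
    oddOff m n (a + 1) ≤ oddOff m n (2 * m - 1) := by
  have := oddOff_le (m := m) (a := a) (b := 2 * m - 2) n (by omega) (by omega)
  rwa [show 2 * m - 2 + 1 = 2 * m - 1 by omega] at this

/-- The gap `faceGap m n k` is a difference of two offsets in exactly two ways. -/
theorem oddOff_sub_eq_faceGap {m a b k : ℕ} {n : ℕ} (hm : 3 ≤ m) (hk : k + 2 ≤ m)
    (ha : a < 2 * m - 1) (hb : b < 2 * m - 1)
    (h : oddOff m n (b + 1) - oddOff m n (a + 1) = faceGap m n k) :
    a = 2 * k ∧ b = 2 * k + 1 ∨ a = 2 * k + 1 ∧ b = 2 * k + 2 := by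
  have h1 := oddOff_odd n hk
  have h2 := oddOff_even_succ n hk
  have hg := faceGap_pos m n k
  have hlt := oddOff_even_lt n hk
  have ha0 := oddOff_nonneg n hm ha
  have hk0 := oddOff_nonneg (a := 2 * k) n hm (by omega)
  rcases Nat.lt_or_ge (2 * k) b with hb1 | hb1
  · obtain rfl | rfl | hb2 : b = 2 * k + 1 ∨ b = 2 * k + 2 ∨ 2 * k + 2 < b := by omega
    · simp only [add_assoc, Nat.reduceAdd] at h
      exact .inl ⟨oddOff_inj (n := n) ha (by omega) (by omega), rfl⟩
    · simp only [add_assoc, Nat.reduceAdd] at h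
      have h3 : oddOff m n (a + 1) = oddOff m n (2 * k + 2) := by omega
      exact .inr ⟨oddOff_inj ha (by omega) h3, rfl⟩
    · obtain ⟨c, rfl⟩ : ∃ c, b = c + 1 := ⟨b - 1, by omega⟩
      obtain ⟨l, hl, hcl, hc⟩ := exists_faceGap n hb
      have hac : a ≤ c := by
        by_contra hac
        have := oddOff_le (m := m) (a := c + 1) (b := a) n (by omega) ha
        omega
      have h3 := oddOff_le (m := m) n hac (by omega)
      have h4 := oddOff_even_lt n hl
      have h5 : oddOff m n (2 * k + 3) ≤ oddOff m n (2 * l + 1) :=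
        oddOff_le n (by omega) (by omega)
      simp only [add_assoc, Nat.reduceAdd] at h
      omega
  · have := oddOff_le (m := m) n hb1 (by omega)
    omega

theorem coe_modulus {m : ℕ} (n : ℕ) (hm : 3 ≤ m) :
    ((2 * (3 ^ (m - 1) + 2 * n - 1) : ℕ) : ℤ) = 2 * oddOff m n (2 * m - 1) := by
  rw [oddOff_last n hm]
  have : 0 < 3 ^ (m - 1) := by positivity
  rw [Nat.cast_mul, Nat.cast_sub (by omega)]
  push_cast
  ring

theorem oddOff_last_pos {m : ℕ} (n : ℕ) (hm : 3 ≤ m) : 0 < oddOff m n (2 * m - 1) := by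
  have := oddOff_lt (m := m) (a := 0) (b := 2 * m - 2) n (by omega) (by omega)
  rw [show 2 * m - 2 + 1 = 2 * m - 1 by omega, zero_add, oddOff_one n hm] at this
  exact this

theorem Fface_injective {m : ℕ} (n : ℕ) (hm : 3 ≤ m)
    (i : ZMod (2 * (3 ^ (m - 1) + 2 * n - 1))) : Function.Injective (Fface m n i) := by
  intro a b h
  have h := add_left_cancel h
  rw [ZMod.intCast_eq_intCast_iff_dvd_sub, coe_modulus n hm] at h
  have := oddOff_last_pos n hm
  have := oddOff_le_last n a.2
  have := oddOff_le_last n b.2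
  have := oddOff_nonneg n hm a.2
  have := oddOff_nonneg n hm b.2
  have h0 := Int.eq_zero_of_abs_lt_dvd h (by rw [abs_lt]; omega)
  exact Fin.ext (oddOff_inj (n := n) a.2 b.2 (by omega))

theorem mem_range_Fface_iff {m n : ℕ} (i v : ZMod (2 * (3 ^ (m - 1) + 2 * n - 1))) :
    v ∈ Set.range (Fface m n i) ↔ -i ∈ Set.range (Fface m n (-v)) := by
  simp only [Set.mem_range, Fface]
  refine exists_congr fun j => ⟨fun h => ?_, fun h => ?_⟩
  · rw [← h]
    ring
  · linear_combination h

/-- A consecutive difference of offsets is a difference of two offsets modulo `N` for exactly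
two values of the subtrahend. -/
theorem exists_pair_oddOff_dvd {m : ℕ} (n : ℕ) (hm : 3 ≤ m) (t : Fin (2 * m - 1)) :
    ∃ p q : Fin (2 * m - 1), p ≠ q ∧ ∀ a : Fin (2 * m - 1),
      (∃ b : Fin (2 * m - 1), 2 * oddOff m n (2 * m - 1) ∣
        (oddOff m n (b + 1) - oddOff m n (a + 1)) -
          (oddOff m n (finRotate (2 * m - 1) t + 1) - oddOff m n (t + 1))) ↔ a = p ∨ a = q := by
  have hH := oddOff_last_pos n hm
  obtain ⟨s, hs⟩ : ∃ s, 2 * m - 1 = s + 1 := ⟨2 * m - 2, by omega⟩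
  have hrot : (finRotate (2 * m - 1) t : ℕ) = if (t : ℕ) = s then 0 else (t : ℕ) + 1 := by
    generalize 2 * m - 1 = r at hs t
    subst hs
    rw [coe_finRotate]
    simp [Fin.ext_iff]
  rw [hrot]
  have ht := t.2
  split_ifs with hts
  · refine ⟨⟨0, by omega⟩, ⟨2 * m - 2, by omega⟩, by simp [Fin.ext_iff]; omega, fun a => ?_⟩
    rw [zero_add, oddOff_one n hm, hts, ← hs]
    have hl : 2 * m - 2 + 1 = 2 * m - 1 := by omega
    constructor
    · rintro ⟨b, hb⟩
      have ha1 := oddOff_le_last n a.2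
      have hb1 := oddOff_le_last n b.2
      have ha0 := oddOff_nonneg n hm a.2
      have hb0 := oddOff_nonneg n hm b.2
      have h1 := oddOff_one n hm
      obtain ⟨c, hc⟩ := hb
      have hc0 : 0 ≤ c := by nlinarith
      have hc1 : c ≤ 1 := by nlinarith
      obtain rfl | rfl : c = 0 ∨ c = 1 := by omega
      · right
        refine Fin.ext (oddOff_inj (n := n) a.2 (by simp; omega) ?_)
        simp only [hl]
        omega
      · left
        refine Fin.ext (oddOff_inj (n := n) a.2 (by simp; omega) ?_)
        simp only [zero_add]
        omega
    · rintro (rfl | rfl)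
      · refine ⟨⟨2 * m - 2, by omega⟩, 1, ?_⟩
        simp only [hl, zero_add, oddOff_one n hm]
        ring
      · refine ⟨⟨0, by omega⟩, 0, ?_⟩
        simp only [hl, zero_add, oddOff_one n hm]
        ring
  · obtain ⟨k, hk, htk, hg⟩ := exists_faceGap (m := m) (j := t) n (by omega)
    have h1 := oddOff_odd n hk
    have h2 := oddOff_even_succ n hk
    rw [add_assoc, hg, add_sub_cancel_left]
    refine ⟨⟨2 * k, by omega⟩, ⟨2 * k + 1, by omega⟩, by simp, fun a => ?_⟩
    constructor
    · rintro ⟨b, hb⟩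
      have ha1 := oddOff_le_last n a.2
      have hb1 := oddOff_le_last n b.2
      have ha0 := oddOff_nonneg n hm a.2
      have hb0 := oddOff_nonneg n hm b.2
      have hgp := faceGap_pos m n k
      have hk0 := oddOff_nonneg (a := 2 * k) n hm (by omega)
      have hk2 : oddOff m n (2 * k + 3) ≤ _ := oddOff_le_last n (by omega)
      have h0 := Int.eq_zero_of_abs_lt_dvd hb (by rw [abs_lt]; omega)
      have := oddOff_sub_eq_faceGap hm hk a.2 b.2 (sub_eq_zero.mp h0)
      simp only [Fin.ext_iff]
      omega
    · rintro (rfl | rfl)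
      · refine ⟨⟨2 * k + 1, by omega⟩, 0, ?_⟩
        simp only [add_assoc, Nat.reduceAdd]
        omega
      · refine ⟨⟨2 * k + 2, by omega⟩, 0, ?_⟩
        simp only [add_assoc, Nat.reduceAdd]
        omega

theorem ncard_range_Fface_inter {m : ℕ} (n : ℕ) (hm : 3 ≤ m)
    (i : ZMod (2 * (3 ^ (m - 1) + 2 * n - 1))) (t : Fin (2 * m - 1)) :
    (Set.range (Fface m n (-Fface m n i t)) ∩
      Set.range (Fface m n (-Fface m n i (finRotate (2 * m - 1) t)))).ncard = 2 := by
  obtain ⟨p, q, hpq, h⟩ := exists_pair_oddOff_dvd n hm t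
  have hinj := Fface_injective n hm (-Fface m n i t)
  refine (congrArg Set.ncard ?_).trans (Set.ncard_pair (hinj.ne hpq))
  rw [← Set.image_pair]
  ext x
  constructor
  · rintro ⟨⟨a, rfl⟩, b, hb⟩
    refine ⟨a, (h a).1 ⟨b, ?_⟩, rfl⟩
    rw [← coe_modulus n hm, ← ZMod.intCast_zmod_eq_zero_iff_dvd]
    simp only [Fface] at hb
    push_cast
    linear_combination hb
  · rintro ⟨a, ha, rfl⟩
    refine ⟨⟨a, rfl⟩, ?_⟩
    obtain ⟨b, hb⟩ := (h a).2 ha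
    rw [← coe_modulus n hm, ← ZMod.intCast_zmod_eq_zero_iff_dvd] at hb
    refine ⟨b, ?_⟩
    simp only [Fface]
    push_cast at hb
    linear_combination hb

/-- self-duality, odd case, Lemma 3: for `m ≥ 3`, `n ≥ 0`,
`N = 2(3^{m-1}+2n-1)` and all `i, v, v' ∈ ℤ/Nℤ`:
(a) `v` is a vertex of `F_i` iff `-i` is a vertex of `F_{-v}`;
(b) if `{v, v'}` is an edge of `F_i` then `F_{-v}` and `F_{-v'}` both contain the vertex
`-i` and their vertex sets intersect in exactly two elements. -/
theorem Fface_self_dual (m n : ℕ) (hm : 3 ≤ m)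
    (i v v' : ZMod (2 * (3 ^ (m - 1) + 2 * n - 1))) :
    (v ∈ Set.range (Fface m n i) ↔ -i ∈ Set.range (Fface m n (-v))) ∧
    (v ≠ v' → IsFedge m n i {v, v'} →
      -i ∈ Set.range (Fface m n (-v)) ∧ -i ∈ Set.range (Fface m n (-v')) ∧
      (Set.range (Fface m n (-v)) ∩ Set.range (Fface m n (-v'))).ncard = 2) := by
  refine ⟨mem_range_Fface_iff i v, ?_⟩
  rintro - ⟨t, ht⟩
  rcases Set.pair_eq_pair_iff.mp ht with ⟨rfl, rfl⟩ | ⟨rfl, rfl⟩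
  · exact ⟨(mem_range_Fface_iff _ _).1 ⟨_, rfl⟩, (mem_range_Fface_iff _ _).1 ⟨_, rfl⟩,
      ncard_range_Fface_inter n hm i t⟩
  · rw [Set.inter_comm]
    exact ⟨(mem_range_Fface_iff _ _).1 ⟨_, rfl⟩, (mem_range_Fface_iff _ _).1 ⟨_, rfl⟩,
      ncard_range_Fface_inter n hm i t⟩
end
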